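/- Let p be an odd prime. The chain complex 0 → K_3 →^{∂_3} K_2 →^{∂_2} K_1 →^{∂_1} K_0 → 0 described in the context is exact: ∂_3 is injective, ker ∂_2 = im ∂_3, ker ∂_1 = im ∂_2, and ∂_1 is surjective. Consequently all its homology groups vanish. -/

import Mathlib

/-- `∂₃ : K₃ → K₂`, `∂₃(x₃) = 4x₂₁ + 4x₂₂⁺ − 4x₂₂⁻`, in the kernel complex
`K_*^{4,2} = ker(C_*(Sal(𝒞₃²)) ⊗_{Σ₄} 𝔽_p(±1) → C_*(Sal(𝒜₃)) ⊗_{Σ₄} 𝔽_p(±1))`.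
The basis of `K₂` is `x₂₁, x₂₂⁺, x₂₂⁻` in this order. -/
def kerD3 (p : ℕ) : (Fin 1 → ZMod p) →ₗ[ZMod p] (Fin 3 → ZMod p) :=
  Matrix.toLin' !![4; 4; -4]

/-- `∂₂ : K₂ → K₁`, `∂₂(x₂₁) = 2x₁₂⁺ − 2x₁₂⁻`, `∂₂(x₂₂⁺) = x₁₁ − 2x₁₂⁺`,
`∂₂(x₂₂⁻) = x₁₁ − 2x₁₂⁻`. The basis of `K₁` is `x₁₁, x₁₂⁺, x₁₂⁻` in this order. -/
def kerD2 (p : ℕ) : (Fin 3 → ZMod p) →ₗ[ZMod p] (Fin 3 → ZMod p) :=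
  Matrix.toLin' !![0, 1, 1; 2, -2, 0; -2, 0, -2]

/-- `∂₁ : K₁ → K₀`, `∂₁(x₁₁) = 2x₀`, `∂₁(x₁₂⁺) = x₀`, `∂₁(x₁₂⁻) = x₀`. -/
def kerD1 (p : ℕ) : (Fin 3 → ZMod p) →ₗ[ZMod p] (Fin 1 → ZMod p) :=
  Matrix.toLin' !![2, 1, 1]

/-- For an odd prime `p`, the kernel complex `0 → K₃ → K₂ → K₁ → K₀ → 0` is exact:
all of its homology groups vanish. -/
theorem kernelComplex_exact (p : ℕ) (hp : p.Prime) (hodd : Odd p) :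
    Function.Injective (kerD3 p) ∧
    LinearMap.ker (kerD2 p) = LinearMap.range (kerD3 p) ∧
    LinearMap.ker (kerD1 p) = LinearMap.range (kerD2 p) ∧
    Function.Surjective (kerD1 p) := by
  have : Fact p.Prime := ⟨hp⟩
  have h2 : (2 : ZMod p) ≠ 0 :=
    Ring.two_ne_zero (by rw [ZMod.ringChar_zmod_n]; rintro rfl; exact absurd hodd (by decide))
  obtain ⟨c, hc⟩ : ∃ c : ZMod p, 2 * c = 1 := ⟨2⁻¹, mul_inv_cancel₀ h2⟩
  have e3 (v) : kerD3 p v = ![4 * v 0, 4 * v 0, -4 * v 0] := by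
    ext i
    fin_cases i <;> simp [kerD3, Matrix.mulVec, dotProduct]
  have e2 (v) : kerD2 p v = ![v 1 + v 2, 2 * v 0 - 2 * v 1, -2 * v 0 - 2 * v 2] := by
    ext i
    fin_cases i <;> simp [kerD2, Matrix.mulVec, dotProduct, Fin.sum_univ_three] <;> ring
  have e1 (v) : kerD1 p v = ![2 * v 0 + v 1 + v 2] := by
    ext i
    fin_cases i
    simp [kerD1, Matrix.mulVec, dotProduct, Fin.sum_univ_three]
  have cancel_two {a b : ZMod p} (h : 2 * a = 2 * b) : a = b := mul_left_cancel₀ h2 h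
  refine ⟨fun v w h => ?_, ?_, ?_, fun w => ⟨![0, w 0, 0], ?_⟩⟩
  · rw [e3, e3] at h
    have h0 : 4 * v 0 = 4 * w 0 := congrFun h 0
    ext i
    fin_cases i
    change v 0 = w 0
    exact cancel_two (cancel_two (by linear_combination h0))
  · ext v
    rw [LinearMap.mem_ker, LinearMap.mem_range, e2]
    constructor
    · intro h
      have h0 : v 1 + v 2 = 0 := congrFun h 0
      have h1 : v 0 = v 1 := cancel_two (sub_eq_zero.mp (congrFun h 1))
      refine ⟨![c * c * v 0], ?_⟩
      rw [e3]
      have key : 4 * (c * c * v 0) = v 0 := by linear_combination (2 * c + 1) * v 0 * hc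
      ext i
      fin_cases i
      · exact key
      · exact key.trans h1
      · change -4 * (c * c * v 0) = v 2
        linear_combination -key - h1 - h0
    · rintro ⟨w, rfl⟩
      rw [e3]
      ext i
      fin_cases i <;> simp
  · ext v
    rw [LinearMap.mem_ker, LinearMap.mem_range, e1]
    constructor
    · intro h
      have h0 : 2 * v 0 + v 1 + v 2 = 0 := congrFun h 0
      refine ⟨![0, -(c * v 1), -(c * v 2)], ?_⟩
      rw [e2]
      ext i
      fin_cases i
      · change -(c * v 1) + -(c * v 2) = v 0
        linear_combination v 0 * hc - c * h0
      · change 2 * 0 - 2 * -(c * v 1) = v 1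
        linear_combination v 1 * hc
      · change -2 * 0 - 2 * -(c * v 2) = v 2
        linear_combination v 2 * hc
    · rintro ⟨w, rfl⟩
      rw [e2]
      ext i
      fin_cases i
      change 2 * (w 1 + w 2) + (2 * w 0 - 2 * w 1) + (-2 * w 0 - 2 * w 2) = 0
      ring
  · rw [e1]
    ext i
    fin_cases i
    simp
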